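/- Let (s_n)_{n≥0} be a sequence of real polynomials, c ∈ ℝ, j ≥ 0 an integer, and let a_n, b_n > 0 satisfy a_n^{−1/2}/(A n^a) → 1 and b_n/(B n^b) → 1 for constants A, B, b > 0 and a ∈ ℝ. Suppose for some ν > −1 that, uniformly on compact subsets of ℂ, (−1)^n (a_n^{1/2}/b_n^j) s_n(c + z²/b_n) → φ_{ν+2j}(z). Then for every fixed integer k ≥ 0, lim_{n→∞} s_n^{(k)}(c) / ((−1)^{n+k} n^{b(k+j)+a}) = A·B^{k+j} / Γ(k+ν+2j+1). -/

import Mathlib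

open Polynomial Filter Topology

noncomputable section

/-- `φ_ν(z) = Σ_{k≥0} (-1)^k z^{2k} / (k! Γ(k+ν+1)) = z^{-ν} J_ν(2z)`. -/
def phi (ν : ℝ) (z : ℂ) : ℂ :=
  ∑' k : ℕ, ((-1 : ℂ) ^ k * z ^ (2 * k)) /
    ((k.factorial : ℂ) * Complex.Gamma ((k : ℂ) + (ν : ℂ) + 1))

/-- The coefficients of `φ_μ` regarded as a power series in `z ^ 2`. -/
def phiCoeff (μ : ℝ) (k : ℕ) : ℝ :=
  (-1) ^ k / (k.factorial * Real.Gamma (k + μ + 1))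

theorem gamma_natCast_add_pos {μ : ℝ} (hμ : -1 < μ) (k : ℕ) : 0 < Real.Gamma (k + μ + 1) :=
  Real.Gamma_pos_of_pos (by have : (0 : ℝ) ≤ k := k.cast_nonneg; linarith)

theorem phiCoeff_ne_zero {μ : ℝ} (hμ : -1 < μ) (k : ℕ) : phiCoeff μ k ≠ 0 := by
  have := (gamma_natCast_add_pos hμ k).ne'
  have := k.factorial_ne_zero
  unfold phiCoeff
  positivity

theorem phiCoeff_succ_div {μ : ℝ} (hμ : -1 < μ) (k : ℕ) :
    |phiCoeff μ (k + 1)| / |phiCoeff μ k| = ((k + 1 : ℝ) * (k + (μ + 1)))⁻¹ := by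
  have hΓ := gamma_natCast_add_pos hμ k
  have hΓ' := gamma_natCast_add_pos hμ (k + 1)
  have hk : (0 : ℝ) < k + μ + 1 := by
    have : (0 : ℝ) ≤ k := k.cast_nonneg
    linarith
  have hrec : Real.Gamma ((k + 1 : ℕ) + μ + 1) = (k + μ + 1) * Real.Gamma (k + μ + 1) := by
    rw [← Real.Gamma_add_one hk.ne']
    push_cast
    ring_nf
  unfold phiCoeff
  rw [abs_div, abs_div, abs_pow, abs_pow, abs_neg, abs_one, one_pow, one_pow, hrec,
    abs_of_pos (by positivity), abs_of_pos (by positivity), Nat.factorial_succ,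
    ← add_assoc (k : ℝ) μ 1]
  push_cast
  field_simp

theorem phi_eq_tsum_phiCoeff (μ : ℝ) (z : ℂ) :
    phi μ z = FormalMultilinearSeries.ofScalarsSum (E := ℂ)
      (fun k => (phiCoeff μ k : ℂ)) (z ^ 2) := by
  rw [FormalMultilinearSeries.ofScalars_sum_eq, phi]
  refine tsum_congr fun k => ?_
  have : Complex.Gamma ((k : ℂ) + (μ : ℂ) + 1) = (Real.Gamma (k + μ + 1) : ℂ) := by
    rw [← Complex.Gamma_ofReal]
    push_cast
    rfl
  rw [this, phiCoeff, smul_eq_mul, pow_mul]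
  push_cast
  ring

theorem hasFPowerSeriesAt_phiCoeff {μ : ℝ} (hμ : -1 < μ) :
    HasFPowerSeriesAt
      (FormalMultilinearSeries.ofScalarsSum (E := ℂ) (fun k => (phiCoeff μ k : ℂ)))
      (FormalMultilinearSeries.ofScalars ℂ (fun k => (phiCoeff μ k : ℂ))) 0 := by
  have hrad : (FormalMultilinearSeries.ofScalars ℂ (fun k => (phiCoeff μ k : ℂ))).radius = ⊤ := by
    refine FormalMultilinearSeries.ofScalars_radius_eq_top_of_tendsto _ _
      (.of_forall fun k => by exact_mod_cast phiCoeff_ne_zero hμ k) ?_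
    simp only [Complex.norm_real, Real.norm_eq_abs, Nat.succ_eq_add_one, phiCoeff_succ_div hμ]
    refine Tendsto.inv_tendsto_atTop (Tendsto.atTop_mul_atTop₀ ?_ ?_)
    · exact tendsto_atTop_add_const_right _ _ tendsto_natCast_atTop_atTop
    · exact tendsto_atTop_add_const_right _ _ tendsto_natCast_atTop_atTop
  exact (FormalMultilinearSeries.hasFPowerSeriesOnBall _ (by simp [hrad])).hasFPowerSeriesAt

theorem HasFPowerSeriesAt.iteratedDeriv_of_ofScalars {f : ℂ → ℂ} {p : ℕ → ℂ} {x : ℂ}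
    (h : HasFPowerSeriesAt f (FormalMultilinearSeries.ofScalars ℂ p) x) (k : ℕ) :
    iteratedDeriv k f x = k.factorial * p k := by
  have h' := congrFun (FormalMultilinearSeries.ofScalars_series_injective ℂ ℂ
    (h.eq_formalMultilinearSeries h.analyticAt.hasFPowerSeriesAt)) k
  have := k.factorial_ne_zero
  simp only [h']
  field_simp

/-- Locally uniform convergence of polynomials passes to all derivatives. -/
theorem tendstoLocallyUniformlyOn_eval_iterate_derivative {P : ℕ → ℂ[X]} {g : ℂ → ℂ}
    (h : TendstoLocallyUniformlyOn (fun n z => (P n).eval z) g atTop Set.univ) (k : ℕ) :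
    TendstoLocallyUniformlyOn (fun n z => (derivative^[k] (P n)).eval z)
      (iteratedDeriv k g) atTop Set.univ := by
  induction k with
  | zero => simpa using h
  | succ k ih =>
    rw [iteratedDeriv_succ]
    refine (ih.deriv (.of_forall fun n => (derivative^[k] (P n)).differentiableOn)
      isOpen_univ).congr fun n z _ => ?_
    rw [Function.iterate_succ_apply', Function.comp_apply, Polynomial.deriv]

theorem eval_zero_iterate_derivative_comp {R : Type*} [CommSemiring R] (p : R[X]) (x y : R)
    (k : ℕ) :
    (derivative^[k] (p.comp (C x + C y * X))).eval 0 = y ^ k * (derivative^[k] p).eval x := by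
  induction k generalizing p with
  | zero => simp
  | succ k ih =>
    simp only [Function.iterate_succ_apply, derivative_comp, derivative_add, derivative_C,
      derivative_C_mul, derivative_X, zero_add, mul_one, iterate_derivative_C_mul, eval_mul,
      eval_C, ih, pow_succ]
    ring

/-- Uniform convergence on compacta of `F n (z ^ 2)` gives that of `F n`. -/
theorem tendstoLocallyUniformlyOn_of_comp_sq {F : ℕ → ℂ → ℂ} {g : ℂ → ℂ}
    (h : ∀ K : Set ℂ, IsCompact K →
      TendstoUniformlyOn (fun n z => F n (z ^ 2)) (fun z => g (z ^ 2)) atTop K) :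
    TendstoLocallyUniformlyOn F g atTop Set.univ := by
  rw [tendstoLocallyUniformlyOn_iff_forall_isCompact isOpen_univ]
  intro K _ hK
  obtain ⟨r, hr⟩ := hK.isBounded.exists_norm_le
  intro u hu
  filter_upwards [h _ (isCompact_closedBall 0 (√r)) u hu] with n hn w hw
  obtain ⟨z, rfl⟩ := IsAlgClosed.exists_pow_nat_eq w two_pos
  refine hn z (mem_closedBall_zero_iff.2 (Real.le_sqrt_of_sq_le ?_))
  simpa using hr _ hw

/-- **Coefficient-wise consequence of a Mehler–Heine formula.** If
`(-1)^n (a_n^{1/2}/b_n^j) s_n(c + z²/b_n) → φ_{ν+2j}(z)` uniformly on compact subsets of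
`ℂ` with `a_n^{-1/2} ≅ A n^a` and `b_n ≅ B n^b`, then for each fixed `k`,
`s_n^{(k)}(c) ≅ (-1)^{n+k} A B^{k+j} n^{b(k+j)+a} / Γ(k+ν+2j+1)`. -/
theorem mehler_heine_coefficientwise
    (s : ℕ → Polynomial ℝ) (c : ℝ) (j : ℕ)
    (a b : ℕ → ℝ) (ha : ∀ n, 0 < a n) (hb : ∀ n, 0 < b n)
    (A B bexp : ℝ) (aexp : ℝ) (hA : 0 < A) (hB : 0 < B) (hbexp : 0 < bexp)
    (ν : ℝ) (hν : -1 < ν)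
    (haA : Filter.Tendsto (fun n : ℕ => (a n) ^ (-(1 : ℝ) / 2) / (A * (n : ℝ) ^ aexp))
      Filter.atTop (nhds 1))
    (hbB : Filter.Tendsto (fun n : ℕ => b n / (B * (n : ℝ) ^ bexp)) Filter.atTop (nhds 1))
    (hMH : ∀ K : Set ℂ, IsCompact K →
      TendstoUniformlyOn
        (fun (n : ℕ) (z : ℂ) =>
          (((-1 : ℝ) ^ n * ((a n) ^ ((1 : ℝ) / 2) / (b n) ^ j) : ℝ) : ℂ) *
            Polynomial.aeval ((c : ℂ) + z ^ 2 / (b n : ℂ)) (s n))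
        (fun z => phi (ν + 2 * j) z) Filter.atTop K) :
    ∀ k : ℕ, Filter.Tendsto
      (fun n : ℕ =>
        (Polynomial.derivative^[k] (s n)).eval c /
          ((-1 : ℝ) ^ (n + k) * (n : ℝ) ^ (bexp * (k + j) + aexp)))
      Filter.atTop
      (nhds (A * B ^ (k + j) / Real.Gamma ((k : ℝ) + ν + 2 * j + 1))) := by
  intro k
  set μ : ℝ := ν + 2 * j with hμ_def
  have hμ : -1 < μ := by
    have : (0 : ℝ) ≤ j := j.cast_nonneg
    linarith
  set D : ℕ → ℝ := fun n => (-1 : ℝ) ^ n * ((a n) ^ ((1 : ℝ) / 2) / (b n) ^ j) with hD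
  set P : ℕ → ℂ[X] := fun n => C (D n : ℂ) *
    ((s n).map (algebraMap ℝ ℂ)).comp (C (c : ℂ) + C ((b n : ℂ)⁻¹) * X) with hP
  have hlim : TendstoLocallyUniformlyOn (fun n z => (P n).eval z)
      (FormalMultilinearSeries.ofScalarsSum (E := ℂ) (fun k => (phiCoeff μ k : ℂ)))
      atTop Set.univ := by
    refine tendstoLocallyUniformlyOn_of_comp_sq fun K hK => ?_
    simp only [← phi_eq_tsum_phiCoeff]
    refine (hMH K hK).congr (.of_forall fun n z _ => ?_)
    simp [hP, hD, aeval_def, eval_map, eval_comp, div_eq_inv_mul]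
  have hderiv := (tendstoLocallyUniformlyOn_eval_iterate_derivative hlim k).tendsto_at
    (Set.mem_univ 0)
  rw [(hasFPowerSeriesAt_phiCoeff hμ).iteratedDeriv_of_ofScalars k] at hderiv
  have heval : ∀ n, (derivative^[k] (P n)).eval 0 =
      ((D n * ((b n)⁻¹ ^ k * (derivative^[k] (s n)).eval c) : ℝ) : ℂ) := fun n => by
    rw [hP, iterate_derivative_C_mul, eval_mul, eval_C, eval_zero_iterate_derivative_comp,
      iterate_derivative_map]
    have : (c : ℂ) = algebraMap ℝ ℂ c := rfl
    rw [this, eval_map_apply]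
    push_cast
    rfl
  simp only [heval] at hderiv
  have hreal : Tendsto (fun n => D n * ((b n)⁻¹ ^ k * (derivative^[k] (s n)).eval c)) atTop
      (𝓝 (k.factorial * phiCoeff μ k)) := by
    rw [← tendsto_ofReal_iff]
    exact_mod_cast hderiv
  have hΓ := gamma_natCast_add_pos hμ k
  have hprod := ((hreal.mul haA).mul (hbB.pow (k + j))).mul_const ((-1) ^ k * (A * B ^ (k + j)))
  have hval : k.factorial * phiCoeff μ k * 1 * 1 ^ (k + j) * ((-1) ^ k * (A * B ^ (k + j))) =
      A * B ^ (k + j) / Real.Gamma ((k : ℝ) + ν + 2 * j + 1) := by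
    have hk := k.factorial_ne_zero
    have hsq : ((-1 : ℝ) ^ k) * (-1) ^ k = 1 := by rw [← mul_pow]; simp
    have harg : (k : ℝ) + ν + 2 * j + 1 = k + μ + 1 := by rw [hμ_def]; ring
    rw [harg, phiCoeff]
    field_simp
    linear_combination hsq
  rw [hval] at hprod
  refine hprod.congr' ?_
  filter_upwards [eventually_gt_atTop 0] with n hn
  have hn' : (0 : ℝ) < n := by exact_mod_cast hn
  have han : (a n) ^ (-(1 : ℝ) / 2) = ((a n) ^ ((1 : ℝ) / 2))⁻¹ := by
    rw [← Real.rpow_neg (ha n).le]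
    norm_num
  have hpow : (n : ℝ) ^ (bexp * (k + j) + aexp) = ((n : ℝ) ^ bexp) ^ (k + j) * (n : ℝ) ^ aexp := by
    rw [Real.rpow_add hn', Real.rpow_mul hn'.le, ← Nat.cast_add, Real.rpow_natCast]
  have h1 := Real.rpow_pos_of_pos (ha n) ((1 : ℝ) / 2)
  have h2 := Real.rpow_pos_of_pos hn' bexp
  have h3 := Real.rpow_pos_of_pos hn' aexp
  have hbn := hb n
  have hsign : (((-1 : ℝ) ^ (n + k)))⁻¹ = (-1) ^ n * (-1) ^ k := by
    rw [← inv_pow, pow_add]; norm_num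
  rw [han, hpow, div_mul_eq_div_div (eval c _), div_eq_mul_inv _ ((-1 : ℝ) ^ (n + k)), hsign, hD]
  simp only
  rw [div_pow, mul_pow, inv_pow, pow_add (b n), pow_add B]
  field_simp
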